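/- arXiv:2312.16216 — 6 statements merged into one kernel-verified Lean document; each statement's English description precedes it below -/
import Mathlib

section
/- (Theorem 1) Let λ ∈ ℝ^r and let x_λ ∈ 𝒳 be a minimizer of x ↦ f₀(x) − 2∑_{i=1}^r λᵢ fᵢ(x) over 𝒳, and set y_λ = (f₀(x_λ), f₁(x_λ), …, f_r(x_λ)) ∈ ℝ^{r+1}. Then y_λ lies in the topological frontier (boundary) of 𝒴. -/
/-- A point of a set in a product of real lines lies on the frontier as soon as decreasing one of
its coordinates always leaves the set. -/
theorem mem_frontier_of_update_notMem {ι : Type*} [DecidableEq ι] {S : Set (ι → ℝ)} {y : ι → ℝ}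
    (i : ι) (hy : y ∈ S) (h : ∀ t < y i, Function.update y i t ∉ S) : y ∈ frontier S := by
  refine ⟨subset_closure hy, fun hint => ?_⟩
  have hcont : Filter.Tendsto (fun t => Function.update y i t) (nhds (y i)) (nhds y) := by
    have hc : Continuous fun t : ℝ => Function.update y i t := continuous_const.update i continuous_id
    simpa using hc.tendsto (y i)
  have hS : ∀ᶠ t in nhdsWithin (y i) (Set.Iio (y i)), Function.update y i t ∈ S :=
    (hcont.eventually (mem_interior_iff_mem_nhds.mp hint)).filter_mono nhdsWithin_le_nhds
  obtain ⟨t, htS, ht⟩ := (hS.and self_mem_nhdsWithin).exists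
  exact h t ht htS


/-- (Theorem 1) If `x_λ` minimizes `x ↦ f₀(x) − 2∑ λᵢ fᵢ(x)` over 𝒳, then the image point
`y_λ = (f₀(x_λ), f₁(x_λ), …, f_r(x_λ))` lies on the topological frontier of 𝒴. -/
theorem support_point_mem_frontier (n r : ℕ) (X : Set (Fin n → ℝ))
    (hXne : X.Nonempty) (hXcomp : IsCompact X) (hXconv : Convex ℝ X)
    (f0 : (Fin n → ℝ) → ℝ) (hf0cont : Continuous f0)
    (hf0conv : ConvexOn ℝ Set.univ f0)
    (C : Matrix (Fin r) (Fin n) ℝ)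
    (f : Fin r → (Fin n → ℝ) → ℝ)
    (hf : ∀ i x, f i x = ∑ j, C i j * x j)
    (y0' : ℝ) (hy0' : ∀ x ∈ X, f0 x ≤ y0')
    (Y : Set (Fin (r + 1) → ℝ))
    (hY : Y = {y | ∃ x ∈ X, f0 x ≤ y 0 ∧ y 0 ≤ y0' ∧ ∀ i : Fin r, y i.succ = f i x})
    (lam : Fin r → ℝ) (xlam : Fin n → ℝ) (hxlamX : xlam ∈ X)
    (hxlammin : ∀ x ∈ X,
      f0 xlam - 2 * ∑ i, lam i * f i xlam ≤ f0 x - 2 * ∑ i, lam i * f i x)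
    (ylam : Fin (r + 1) → ℝ)
    (hylam : ylam = Fin.cons (f0 xlam) (fun i => f i xlam)) :
    ylam ∈ frontier Y := by
  subst hY hylam
  refine mem_frontier_of_update_notMem 0 ⟨xlam, hxlamX, by simp, by simpa using hy0' xlam hxlamX,
    by simp⟩ ?_
  rintro t ht ⟨x, hxX, hx0, -, hxf⟩
  have hf_eq : ∀ i, f i xlam = f i x := fun i => by simpa using hxf i
  have hmin := hxlammin x hxX
  simp only [hf_eq] at hmin
  simp only [Function.update_self, Fin.cons_zero] at hx0 ht
  linarith
end

section
/- (Theorem 3, core gap bound) Let v¹,…,v^{r+1} ∈ ℝ^r, let d_S = max_j ‖v^j‖ and d(S) = max_{i<j} ‖vⁱ − vʲ‖. For each j let x_{v^j} ∈ 𝒳 be a minimizer of x ↦ f₀(x) − 2∑_{i=1}^r v^j_i fᵢ(x) over 𝒳, with optimal value μ_{v^j}. Then every (y₀, w) ∈ ℝ × Δ_r satisfying y₀ − 2∑_{i=1}^r v^j_i (∑_{s=1}^{r+1} w_s v^s_i) ≥ μ_{v^j} for all j = 1,…,r+1 obeys y₀ + ∑_{j=1}^{r+1} w_j(−‖v^j‖²)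 ≥ min_{1≤j≤r+1} ( f₀(x_{v^j}) − ∑_{i=1}^r (fᵢ(x_{v^j}))² ) − 4 d_S d(S). -/
open scoped InnerProductSpace in
/-- If `‖a‖ ≤ R` and every `b s` is within `D` of `a`, then the inner product of `a` with a convex
combination of the `b s` is at least `‖a‖ ^ 2 - R * D`. -/
theorem norm_sq_sub_le_inner_sum_smul {E ι : Type*} [NormedAddCommGroup E] [InnerProductSpace ℝ E]
    [Fintype ι] {a : E} {b : ι → E} {w : ι → ℝ} {R D : ℝ} (hw0 : ∀ s, 0 ≤ w s)
    (hw1 : ∑ s, w s = 1) (ha : ‖a‖ ≤ R) (hb : ∀ s, ‖a - b s‖ ≤ D) :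
    ‖a‖ ^ 2 - R * D ≤ ⟪a, ∑ s, w s • b s⟫_ℝ := by
  have hpair (s : ι) : ‖a‖ ^ 2 - R * D ≤ ⟪a, b s⟫_ℝ := by
    have h : ⟪a, a - b s⟫_ℝ ≤ R * D :=
      (real_inner_le_norm _ _).trans
        (mul_le_mul ha (hb s) (norm_nonneg _) ((norm_nonneg _).trans ha))
    rw [inner_sub_right, real_inner_self_eq_norm_sq] at h
    linarith
  calc ‖a‖ ^ 2 - R * D = ∑ s, w s * (‖a‖ ^ 2 - R * D) := by rw [← Finset.sum_mul, hw1, one_mul]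
    _ ≤ ∑ s, w s * ⟪a, b s⟫_ℝ :=
      Finset.sum_le_sum fun s _ => mul_le_mul_of_nonneg_left (hpair s) (hw0 s)
    _ = ⟪a, ∑ s, w s • b s⟫_ℝ := by simp only [inner_sum, real_inner_smul_right]

/-- Completing the square: `2 ⟨v, p⟩ ≤ ‖p‖ ^ 2 + ‖v‖ ^ 2` in coordinates. -/
theorem EuclideanSpace.two_mul_sum_mul_le {ι : Type*} [Fintype ι] (v : EuclideanSpace ℝ ι)
    (p : ι → ℝ) : 2 * ∑ i, v i * p i ≤ ∑ i, p i ^ 2 + ‖v‖ ^ 2 := by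
  rw [EuclideanSpace.real_norm_sq_eq, Finset.mul_sum, ← Finset.sum_add_distrib]
  exact Finset.sum_le_sum fun i _ => by nlinarith [sq_nonneg (v i - p i)]


/-- (Theorem 3, core gap bound) Every feasible point `(y₀, w)` of the relaxed linear
program over the simplex with vertices `v¹,…,v^{r+1}` has objective value at least
`min_j ( f₀(x_{v^j}) − ∑ᵢ (fᵢ(x_{v^j}))² ) − 4 d_S d(S)`. -/
theorem relaxation_gap_bound (n r : ℕ) (X : Set (Fin n → ℝ))
    (hXne : X.Nonempty) (hXcomp : IsCompact X) (hXconv : Convex ℝ X)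
    (f0 : (Fin n → ℝ) → ℝ) (hf0cont : Continuous f0)
    (hf0conv : ConvexOn ℝ Set.univ f0)
    (C : Matrix (Fin r) (Fin n) ℝ)
    (f : Fin r → (Fin n → ℝ) → ℝ)
    (hf : ∀ i x, f i x = ∑ j, C i j * x j)
    (v : Fin (r + 1) → EuclideanSpace ℝ (Fin r))
    (dS dDiam : ℝ)
    (hdS : IsGreatest (Set.range fun j => ‖v j‖) dS)
    (hdDiam : IsGreatest {c : ℝ | ∃ i j : Fin (r + 1), i < j ∧ c = ‖v i - v j‖} dDiam)
    (xv : Fin (r + 1) → (Fin n → ℝ)) (hxvX : ∀ j, xv j ∈ X)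
    (hxvmin : ∀ j, ∀ x ∈ X,
      f0 (xv j) - 2 * ∑ i, v j i * f i (xv j) ≤ f0 x - 2 * ∑ i, v j i * f i x)
    (μ : Fin (r + 1) → ℝ)
    (hμ : ∀ j, μ j = f0 (xv j) - 2 * ∑ i, v j i * f i (xv j))
    (y0 : ℝ) (w : Fin (r + 1) → ℝ) (hw0 : ∀ j, 0 ≤ w j) (hw1 : ∑ j, w j = 1)
    (hfeas : ∀ j, y0 - 2 * ∑ i, v j i * (∑ s, w s * v s i) ≥ μ j) :
    y0 + ∑ j, w j * (-‖v j‖ ^ 2) ≥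
      (Finset.univ.inf' Finset.univ_nonempty
        (fun j : Fin (r + 1) => f0 (xv j) - ∑ i : Fin r, (f i (xv j)) ^ 2)) -
        4 * dS * dDiam := by
  set m := Finset.univ.inf' Finset.univ_nonempty
    (fun j : Fin (r + 1) => f0 (xv j) - ∑ i : Fin r, (f i (xv j)) ^ 2)
  have hv (j) : ‖v j‖ ≤ dS := hdS.2 ⟨j, rfl⟩
  have hdS0 : 0 ≤ dS := (norm_nonneg _).trans (hv 0)
  have hdDiam0 : 0 ≤ dDiam := by
    obtain ⟨i, j, -, h⟩ := hdDiam.1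
    exact h ▸ norm_nonneg _
  have hdist (j s) : ‖v j - v s‖ ≤ dDiam := by
    rcases lt_trichotomy j s with h | rfl | h
    · exact hdDiam.2 ⟨j, s, h, rfl⟩
    · simpa using hdDiam0
    · exact hdDiam.2 ⟨s, j, h, norm_sub_rev _ _⟩
  have hvertex (j) : m + ‖v j‖ ^ 2 - 2 * (dS * dDiam) ≤ y0 := by
    have hinner := norm_sq_sub_le_inner_sum_smul hw0 hw1 (hv j) (hdist j)
    have hcoord : inner ℝ (v j) (∑ s, w s • v s) = ∑ i, v j i * ∑ s, w s * v s i := by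
      simp [PiLp.inner_apply, mul_comm]
    have hmj : m ≤ f0 (xv j) - ∑ i, f i (xv j) ^ 2 :=
      Finset.inf'_le (fun j => f0 (xv j) - ∑ i, f i (xv j) ^ 2) (Finset.mem_univ j)
    have hsq := EuclideanSpace.two_mul_sum_mul_le (v j) fun i => f i (xv j)
    have hfeasj := hfeas j
    rw [hμ j] at hfeasj
    linarith
  have havg : m + ∑ j, w j * ‖v j‖ ^ 2 - 2 * (dS * dDiam) ≤ y0 := by
    have h := Finset.sum_le_sum fun j (_ : j ∈ Finset.univ) =>
      mul_le_mul_of_nonneg_left (hvertex j) (hw0 j)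
    simp only [mul_sub, mul_add, Finset.sum_sub_distrib, Finset.sum_add_distrib,
      ← Finset.sum_mul, hw1, one_mul] at h
    exact h
  simp only [mul_neg, Finset.sum_neg_distrib]
  linarith [mul_nonneg hdS0 hdDiam0]
end

section
/- (Theorem 3, ε-optimality) Let ε > 0, let v¹,…,v^{r+1} ∈ ℝ^r, let d_S = max_j ‖v^j‖ and d(S) = max_{i<j} ‖vⁱ − vʲ‖, and suppose 4 d_S d(S) ≤ ε. For each j let x_{v^j} ∈ 𝒳 be a minimizer of x ↦ f₀(x) − 2∑_{i=1}^r v^j_i fᵢ(x) over 𝒳, with optimal value μ_{v^j}. Suppose there exists (ỹ₀, w̃) ∈ ℝ × Δ_r satisfying the constraints ỹ₀ − 2∑_{i=1}^r v^j_i (∑_{s=1}^{r+1} w̃_s v^s_i) ≥ μ_{v^j} for all j, whose objective value satisfies ỹ₀ + ∑_{j=1}^{r+1} w̃_j(−‖v^j‖²) ≤ inf_{x∈𝒳} ( f₀(x) − ∑_{i=1}^r (fᵢ(x))² ). Then min_{1≤j≤r+1} ( f₀(x_{v^j}) − ∑_{i=1}^r (fᵢ(x_{v^j}))² ) ≤ inf_{x∈𝒳}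 ( f₀(x) − ∑_{i=1}^r (fᵢ(x))² ) + ε; that is, the best incumbent point among x_{v¹},…,x_{v^{r+1}} is a global ε-optimal solution. -/
/-- The weighted mean of the squared distances from `p` to the points `v s`, expanded. -/
theorem sum_weighted_norm_sub_sq {ι κ : Type*} [Fintype ι] [Fintype κ]
    (v : ι → EuclideanSpace ℝ κ) (w : ι → ℝ) (hw : ∑ s, w s = 1) (p : EuclideanSpace ℝ κ) :
    ∑ s, w s * ‖p - v s‖ ^ 2 =
      ‖p‖ ^ 2 - 2 * ∑ i, p i * (∑ s, w s * v s i) + ∑ s, w s * ‖v s‖ ^ 2 := by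
  have hcross : ∑ i, p i * (∑ s, w s * v s i) = ∑ s, w s * ∑ i, p i * v s i := by
    simp_rw [Finset.mul_sum]
    rw [Finset.sum_comm]
    exact Finset.sum_congr rfl fun s _ => Finset.sum_congr rfl fun i _ => by ring
  have hexpand : ∀ s, w s * ‖p - v s‖ ^ 2 =
      w s * ‖p‖ ^ 2 - 2 * (w s * ∑ i, p i * v s i) + w s * ‖v s‖ ^ 2 := by
    intro s
    have hinner : inner ℝ p (v s) = ∑ i, p i * v s i := by
      simp [PiLp.inner_apply, mul_comm]
    rw [norm_sub_sq_real, hinner]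
    ring
  simp_rw [hexpand]
  rw [Finset.sum_add_distrib, Finset.sum_sub_distrib, ← Finset.sum_mul, ← Finset.mul_sum, hw,
    hcross, one_mul]

/-- Linearizing the concave function `-∑ aᵢ²` at `p` gives an upper bound. -/
theorem neg_sum_sq_le {κ : Type*} [Fintype κ] (p : EuclideanSpace ℝ κ) (a : κ → ℝ) :
    -∑ i, a i ^ 2 ≤ ‖p‖ ^ 2 - 2 * ∑ i, p i * a i := by
  have h : 0 ≤ ∑ i, (p i - a i) ^ 2 := Finset.sum_nonneg fun i _ => sq_nonneg _
  have hexpand : ∑ i, (p i - a i) ^ 2 =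
      ∑ i, p i ^ 2 - 2 * ∑ i, p i * a i + ∑ i, a i ^ 2 := by
    rw [Finset.mul_sum, ← Finset.sum_sub_distrib, ← Finset.sum_add_distrib]
    exact Finset.sum_congr rfl fun i _ => by ring
  rw [EuclideanSpace.real_norm_sq_eq]
  linarith

/-- (Theorem 3, ε-optimality) If `4 d_S d(S) ≤ ε` and the relaxed linear program over the
simplex admits a feasible point whose objective value is at most
`inf_{x∈𝒳} ( f₀(x) − ∑ᵢ (fᵢ(x))² )`, then the best incumbent among the minimizers
`x_{v¹},…,x_{v^{r+1}}` is a global ε-optimal solution. -/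
theorem epsilon_optimality (n r : ℕ) (X : Set (Fin n → ℝ))
    (hXne : X.Nonempty) (hXcomp : IsCompact X) (hXconv : Convex ℝ X)
    (f0 : (Fin n → ℝ) → ℝ) (hf0cont : Continuous f0)
    (hf0conv : ConvexOn ℝ Set.univ f0)
    (C : Matrix (Fin r) (Fin n) ℝ)
    (f : Fin r → (Fin n → ℝ) → ℝ)
    (hf : ∀ i x, f i x = ∑ j, C i j * x j)
    (ε : ℝ) (hε : 0 < ε)
    (v : Fin (r + 1) → EuclideanSpace ℝ (Fin r))
    (dS dDiam : ℝ)
    (hdS : IsGreatest (Set.range fun j => ‖v j‖) dS)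
    (hdDiam : IsGreatest {c : ℝ | ∃ i j : Fin (r + 1), i < j ∧ c = ‖v i - v j‖} dDiam)
    (hsmall : 4 * dS * dDiam ≤ ε)
    (xv : Fin (r + 1) → (Fin n → ℝ)) (hxvX : ∀ j, xv j ∈ X)
    (hxvmin : ∀ j, ∀ x ∈ X,
      f0 (xv j) - 2 * ∑ i, v j i * f i (xv j) ≤ f0 x - 2 * ∑ i, v j i * f i x)
    (μ : Fin (r + 1) → ℝ)
    (hμ : ∀ j, μ j = f0 (xv j) - 2 * ∑ i, v j i * f i (xv j))
    (y0t : ℝ) (wt : Fin (r + 1) → ℝ) (hw0 : ∀ j, 0 ≤ wt j) (hw1 : ∑ j, wt j = 1)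
    (hfeas : ∀ j, y0t - 2 * ∑ i, v j i * (∑ s, wt s * v s i) ≥ μ j)
    (hobj : y0t + ∑ j, wt j * (-‖v j‖ ^ 2) ≤
      sInf ((fun x => f0 x - ∑ i : Fin r, (f i x) ^ 2) '' X)) :
    (Finset.univ.inf' Finset.univ_nonempty
        (fun j : Fin (r + 1) => f0 (xv j) - ∑ i : Fin r, (f i (xv j)) ^ 2)) ≤
      sInf ((fun x => f0 x - ∑ i : Fin r, (f i x) ^ 2) '' X) + ε := by
  refine (Finset.inf'_le _ (Finset.mem_univ 0)).trans ?_
  have hnorm : ∀ j, ‖v j‖ ≤ dS := fun j => hdS.2 ⟨j, rfl⟩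
  have hdS0 : 0 ≤ dS := (norm_nonneg _).trans (hnorm 0)
  have hdDiam0 : 0 ≤ dDiam := by
    obtain ⟨i, j, -, h⟩ := hdDiam.1
    exact h ▸ norm_nonneg _
  have hdist : ∀ s, ‖v 0 - v s‖ ≤ dDiam := by
    intro s
    rcases eq_or_ne s 0 with rfl | hs
    · simpa using hdDiam0
    · exact hdDiam.2 ⟨0, s, Fin.pos_of_ne_zero hs, rfl⟩
  have hsq : ∀ s, ‖v 0 - v s‖ ^ 2 ≤ ε := by
    intro s
    have h2 : ‖v 0 - v s‖ ≤ 2 * dS := by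
      linarith [norm_sub_le (v 0) (v s), hnorm 0, hnorm s]
    have hmul := mul_le_mul h2 (hdist s) (norm_nonneg _) (by positivity)
    nlinarith [mul_nonneg hdS0 hdDiam0]
  have hmean : ∑ s, wt s * ‖v 0 - v s‖ ^ 2 ≤ ε := by
    calc ∑ s, wt s * ‖v 0 - v s‖ ^ 2 ≤ ∑ s, wt s * ε :=
          Finset.sum_le_sum fun s _ => mul_le_mul_of_nonneg_left (hsq s) (hw0 s)
      _ = ε := by rw [← Finset.sum_mul, hw1, one_mul]
  rw [sum_weighted_norm_sub_sq v wt hw1] at hmean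
  have hlin := neg_sum_sq_le (v 0) fun i => f i (xv 0)
  have hfeas0 := hfeas 0
  rw [hμ 0] at hfeas0
  simp only [mul_neg, Finset.sum_neg_distrib] at hobj
  linarith
end

section
/- (Simplicial bisection: intersection) Let v¹,…,v^{r+1} ∈ ℝ^r be affinely independent, fix indices ĩ ≠ j̃ in {1,…,r+1}, and let η = (v^ĩ + v^j̃)/2. Define S₁ = conv({v^l : l ≠ j̃} ∪ {η}) and S₂ = conv({v^l : l ≠ ĩ} ∪ {η}). Then S₁ ∩ S₂ = conv({v^l : l ≠ ĩ, l ≠ j̃} ∪ {η}). -/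
open Finset in
/-- Every point of the piece of a bisected simplex that omits the vertex `v j` is a convex
combination of the `v l` in which the weight of `v j` is at most that of `v i`. -/
theorem exists_weights_of_mem_convexHull_bisection {ι E : Type*} [Fintype ι] [AddCommGroup E]
    [Module ℝ E] (v : ι → E) {i j : ι} (hij : i ≠ j) {x : E}
    (hx : x ∈ convexHull ℝ ((v '' {l | l ≠ j}) ∪ {(1 / 2 : ℝ) • (v i + v j)})) :
    ∃ w : ι → ℝ, (∀ l, 0 ≤ w l) ∧ ∑ l, w l = 1 ∧ w j ≤ w i ∧ ∑ l, w l • v l = x := by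
  classical
  let s : Set E := {y | ∃ w : ι → ℝ, (∀ l, 0 ≤ w l) ∧ ∑ l, w l = 1 ∧ w j ≤ w i ∧
    ∑ l, w l • v l = y}
  have hs : Convex ℝ s := by
    rintro _ ⟨w, hw, hw1, hwij, rfl⟩ _ ⟨u, hu, hu1, huij, rfl⟩ a b ha hb hab
    refine ⟨fun l => a * w l + b * u l, fun l => ?_, ?_, ?_, ?_⟩
    · have := hw l
      have := hu l
      positivity
    · rw [sum_add_distrib, ← mul_sum, ← mul_sum, hw1, hu1, mul_one, mul_one, hab]
    · dsimp only
      gcongr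
    · simp only [add_smul, mul_smul, sum_add_distrib, smul_sum]
  refine convexHull_min ?_ hs hx
  rintro _ (⟨k, hk, rfl⟩ | rfl)
  · refine ⟨Pi.single k 1, fun l => ?_, by simp, ?_, by simp [Pi.single_apply]⟩
    · by_cases h : l = k <;> simp [h]
    · have hjk : j ≠ k := Ne.symm hk
      by_cases h : i = k <;> simp [h, hjk]
  · refine ⟨fun l => (Pi.single i (1 / 2) + Pi.single j (1 / 2) : ι → ℝ) l,
      fun l => ?_, ?_, ?_, ?_⟩
    · by_cases h : l = i <;> by_cases h' : l = j <;> simp [Pi.single_apply, h, h'] <;> grind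
    · simp only [Pi.add_apply, sum_add_distrib, sum_pi_single', mem_univ, if_true]
      norm_num
    · simp [hij, hij.symm]
    · simp [Pi.single_apply, add_smul, sum_add_distrib]

open Finset in
/-- A convex combination of the `v l` with equal weights at `v i` and `v j` lies in the convex hull
of the midpoint of `v i` and `v j` and the remaining points. -/
theorem sum_smul_mem_convexHull_midpoint {ι E : Type*} [Fintype ι] [AddCommGroup E]
    [Module ℝ E] (v : ι → E) {i j : ι} (hij : i ≠ j) {w : ι → ℝ} (hw : ∀ l, 0 ≤ w l)
    (hw1 : ∑ l, w l = 1) (hwij : w i = w j) :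
    ∑ l, w l • v l ∈
      convexHull ℝ ((v '' {l | l ≠ i ∧ l ≠ j}) ∪ {(1 / 2 : ℝ) • (v i + v j)}) := by
  classical
  let z : ι → E := fun l => if l = i ∨ l = j then (1 / 2 : ℝ) • (v i + v j) else v l
  have hz : ∑ l, w l • v l = ∑ l, w l • z l := by
    rw [← sub_eq_zero, ← sum_sub_distrib, Fintype.sum_eq_add i j hij]
    · simp only [z, true_or, or_true, if_true, hwij]
      module
    · rintro l ⟨hi, hj⟩
      simp [z, hi, hj]
  rw [hz]
  refine (convex_convexHull ℝ _).sum_mem (fun l _ => hw l) hw1 fun l _ => subset_convexHull ℝ _ ?_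
  by_cases h : l = i ∨ l = j
  · simp [z, h]
  · simp only [z, if_neg h]
    exact Or.inl ⟨l, not_or.mp h, rfl⟩

/-- (Simplicial bisection: intersection) If `v¹,…,v^{r+1}` are affinely independent and
`η = (v^ĩ + v^j̃)/2`, then the two subsimplices obtained by bisection intersect exactly in
the common face `conv({v^l : l ≠ ĩ, l ≠ j̃} ∪ {η})`. -/
theorem simplicial_bisection_intersection (r : ℕ) (v : Fin (r + 1) → (Fin r → ℝ))
    (hv : AffineIndependent ℝ v)
    (i0 j0 : Fin (r + 1)) (hij : i0 ≠ j0)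
    (η : Fin r → ℝ) (hη : η = (1 / 2 : ℝ) • (v i0 + v j0)) :
    convexHull ℝ ((v '' {l | l ≠ j0}) ∪ {η}) ∩ convexHull ℝ ((v '' {l | l ≠ i0}) ∪ {η}) =
      convexHull ℝ ((v '' {l | l ≠ i0 ∧ l ≠ j0}) ∪ {η}) := by
  subst hη
  apply Set.Subset.antisymm
  · rintro x ⟨h₁, h₂⟩
    obtain ⟨w, hw, hw1, hwij, rfl⟩ := exists_weights_of_mem_convexHull_bisection v hij h₁
    rw [add_comm (v i0)] at h₂
    obtain ⟨u, -, hu1, huij, hux⟩ := exists_weights_of_mem_convexHull_bisection v hij.symm h₂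
    have huw : ∀ l, u l = w l := fun l => sub_eq_zero.mp <|
      affineIndependent_iff.mp hv Finset.univ (fun l => u l - w l)
        (by rw [Finset.sum_sub_distrib, hu1, hw1, sub_self])
        (by simp only [sub_smul, Finset.sum_sub_distrib, hux, sub_self]) l (Finset.mem_univ l)
    rw [huw, huw] at huij
    exact sum_smul_mem_convexHull_midpoint v hij hw hw1 (le_antisymm huij hwij)
  · refine Set.subset_inter (convexHull_mono ?_) (convexHull_mono ?_)
    · exact Set.union_subset_union_left _ (Set.image_mono fun l hl => hl.2)
    · exact Set.union_subset_union_left _ (Set.image_mono fun l hl => hl.1)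
end

section
/- (Volume bound for simplices with short edges) Let r ≥ 1, a > 0, and let v¹,…,v^{r+1} ∈ ℝ^r satisfy ‖vⁱ − vʲ‖ ≤ a for all i ≠ j. Then the r-dimensional Lebesgue measure of conv{v¹,…,v^{r+1}} is at most (√(r+1)/r!) · (a/√2)^r, the volume of a regular r-simplex with edge length a. -/
open MeasureTheory in
theorem volume_corner_simplex_le (r : ℕ) [NeZero r] :
    volume {x : Fin r → ℝ | (∀ i, 0 ≤ x i) ∧ ∑ i, x i ≤ 1} ≤
      ENNReal.ofReal (1 / (Nat.factorial r : ℝ)) := by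
  set S : Set (Fin r → ℝ) := {x | (∀ i, 0 < x i) ∧ ∑ i, x i ≤ 1} with hS
  have hSm : MeasurableSet S := by
    have : S = (⋂ i, {x : Fin r → ℝ | 0 < x i}) ∩ {x : Fin r → ℝ | ∑ i, x i ≤ 1} := by
      ext x; simp [hS]
    rw [this]
    refine (MeasurableSet.iInter fun i => measurableSet_lt (by fun_prop) (by fun_prop)).inter
      (measurableSet_le (by fun_prop) (by fun_prop))
  have hle : volume {x : Fin r → ℝ | (∀ i, 0 ≤ x i) ∧ ∑ i, x i ≤ 1} ≤ volume S := by
    have hsub : {x : Fin r → ℝ | (∀ i, 0 ≤ x i) ∧ ∑ i, x i ≤ 1} ⊆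
        S ∪ ⋃ i, {x : Fin r → ℝ | x i = 0} := by
      rintro x ⟨h0, h1⟩
      by_cases h : ∃ i, x i = 0
      · exact Or.inr (by simpa using h)
      · push Not at h
        exact Or.inl ⟨fun i => lt_of_le_of_ne (h0 i) (h i).symm, h1⟩
    refine (measure_mono hsub).trans ((measure_union_le _ _).trans ?_)
    rw [measure_iUnion_null fun i => ?_, add_zero]
    exact Measure.pi_hyperplane (fun _ => volume) i 0
  refine hle.trans ?_
  let f (e : Fin r → Bool) (x : Fin r → ℝ) : Fin r → ℝ := fun i => if e i then x i else - x i
  have hf (e) : MeasurePreserving (f e) := by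
    refine volume_preserving_pi (f := fun i (y : ℝ) => if e i then y else - y) fun i => ?_
    cases e i
    · simpa using Measure.measurePreserving_neg (volume : Measure ℝ)
    · simpa using! MeasurePreserving.id (volume : Measure ℝ)
  have hdisj : Pairwise (Function.onFun Disjoint fun e => f e ⁻¹' S) := by
    intro e e' hne
    refine Set.disjoint_left.mpr fun x hx hx' => hne (funext fun i => ?_)
    have h1 := hx.1 i
    have h2 := hx'.1 i
    simp only [f] at h1 h2
    cases h : e i <;> cases h' : e' i <;> simp [h, h'] at h1 h2 ⊢ <;> linarith
  have hball : (⋃ e, f e ⁻¹' S) ⊆ {x | (∑ i, |x i| ^ (1 : ℝ)) ^ (1 / (1 : ℝ)) ≤ 1} := by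
    refine Set.iUnion_subset fun e x hx => ?_
    simp only [Set.mem_ofPred_eq, Real.rpow_one, div_one]
    refine le_of_eq_of_le (Finset.sum_congr rfl fun i _ => ?_) hx.2
    have h1 := hx.1 i
    simp only [f] at h1 ⊢
    cases h : e i <;> simp [h] at h1 ⊢ <;> linarith
  have hvol := measure_mono (μ := volume) hball
  rw [measure_iUnion hdisj fun e => (hf e).measurable hSm, volume_sum_rpow_le (Fin r) (le_refl (1 : ℝ)), tsum_fintype]
    at hvol
  simp_rw [(hf _).measure_preimage hSm.nullMeasurableSet] at hvol
  have h2 : (2 : ENNReal) ^ r * volume S ≤ 2 ^ r * ENNReal.ofReal (1 / (Nat.factorial r : ℝ)) := by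
    refine le_of_eq_of_le (by simp) (hvol.trans_eq ?_)
    have : Real.Gamma ((1 : ℝ) / 1 + 1) = 1 := by norm_num
    rw [this, div_one, Fintype.card_fin, Real.Gamma_nat_eq_factorial,
      div_eq_mul_one_div, ENNReal.ofReal_mul (by positivity), ENNReal.ofReal_pow (by positivity)]
    simp
  exact (ENNReal.mul_le_mul_iff_right (by simp) (by finiteness)).mp h2

theorem Real.prod_le_arith_mean_pow {ι : Type*} [Fintype ι] [Nonempty ι] (z : ι → ℝ)
    (hz : ∀ i, 0 ≤ z i) :
    ∏ i, z i ≤ ((∑ i, z i) / Fintype.card ι) ^ Fintype.card ι := by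
  have hc : (0 : ℝ) < Fintype.card ι := by exact_mod_cast Fintype.card_pos
  have h := Real.geom_mean_le_arith_mean Finset.univ (fun _ => (1 : ℝ)) z (by simp)
    (by simpa using Fintype.card_pos) (fun i _ => hz i)
  simp only [Real.rpow_one, one_mul, Finset.sum_const, Finset.card_univ, nsmul_eq_mul,
    mul_one] at h
  have hp : 0 ≤ ∏ i, z i := Finset.prod_nonneg fun i _ => hz i
  refine le_of_eq_of_le ?_ (pow_le_pow_left₀ (Real.rpow_nonneg hp _) h _)
  rw [Real.rpow_inv_natCast_pow hp Fintype.card_ne_zero]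

open Matrix in
theorem Matrix.det_sq_le_trace_div_card_pow {n : Type*} [Fintype n] [DecidableEq n] [Nonempty n]
    (P : Matrix n n ℝ) :
    P.det ^ 2 ≤ ((Pᵀ * P).trace / Fintype.card n) ^ Fintype.card n := by
  have hP : (Pᵀ * P).PosSemidef := by
    simpa using posSemidef_conjTranspose_mul_self P
  have hdet := hP.1.det_eq_prod_eigenvalues
  have htr := hP.1.trace_eq_sum_eigenvalues
  simp only [det_mul, det_transpose, RCLike.ofReal_real_eq_id, id] at hdet htr
  rw [sq, hdet, htr]
  exact Real.prod_le_arith_mean_pow _ hP.eigenvalues_nonneg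

open Matrix in
theorem Matrix.det_one_sub_smul_ones {n : Type*} [Fintype n] [DecidableEq n] (c : ℝ) :
    (1 - c • Matrix.of (fun _ _ => 1) : Matrix n n ℝ).det = 1 - Fintype.card n * c := by
  have h := det_one_add_replicateCol_mul_replicateRow (ι := Unit) (fun _ : n => -c) (fun _ => 1)
  have e : (1 + replicateCol Unit (fun _ : n => -c) *
      replicateRow Unit (fun _ : n => (1 : ℝ))) =
      (1 - c • Matrix.of (fun _ _ => 1) : Matrix n n ℝ) := by
    ext i j
    simp [mul_apply, sub_eq_add_neg]
  rw [e] at h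
  rw [h]
  simp [dotProduct, sub_eq_add_neg]

/-- The squared norms of `r` vectors, corrected by the squared norm of their sum, are controlled
by bounds on the vectors and their mutual distances. -/
theorem card_add_one_mul_sum_norm_sq_sub_norm_sum_sq_le {E ι : Type*} [NormedAddCommGroup E]
    [InnerProductSpace ℝ E] [Fintype ι] (w : ι → E) (a : ℝ)
    (hw : ∀ i, ‖w i‖ ≤ a) (hww : ∀ i j, i ≠ j → ‖w i - w j‖ ≤ a) :
    (Fintype.card ι + 1) * ∑ i, ‖w i‖ ^ 2 - ‖∑ i, w i‖ ^ 2 ≤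
      Fintype.card ι * (Fintype.card ι + 1) / 2 * a ^ 2 := by
  classical
  have hsum : ∑ i, ∑ j, ‖w i - w j‖ ^ 2 =
      2 * (Fintype.card ι * ∑ i, ‖w i‖ ^ 2 - ‖∑ i, w i‖ ^ 2) := by
    rw [← real_inner_self_eq_norm_sq (∑ i, w i)]
    simp only [norm_sub_sq_real, Finset.sum_add_distrib, Finset.sum_sub_distrib, sum_inner,
      inner_sum, Finset.sum_const, Finset.card_univ, nsmul_eq_mul, ← Finset.mul_sum]
    rw [Finset.sum_comm (f := fun i j => inner ℝ (w j) (w i))]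
    ring
  have h1 : ∑ i, ‖w i‖ ^ 2 ≤ Fintype.card ι * a ^ 2 := by
    refine (Finset.sum_le_sum fun i _ => pow_le_pow_left₀ (norm_nonneg _) (hw i) 2).trans_eq ?_
    simp
  have h2 : ∑ i, ∑ j, ‖w i - w j‖ ^ 2 ≤
      Fintype.card ι * (Fintype.card ι * a ^ 2 - a ^ 2) := by
    have : ∀ i, ∑ j, ‖w i - w j‖ ^ 2 ≤ Fintype.card ι * a ^ 2 - a ^ 2 := fun i => by
      have : ∀ j, ‖w i - w j‖ ^ 2 ≤ a ^ 2 - if i = j then a ^ 2 else 0 := fun j => by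
        split_ifs with h
        · simp [h]
        · simpa using pow_le_pow_left₀ (norm_nonneg _) (hww i j h) 2
      refine (Finset.sum_le_sum fun j _ => this j).trans_eq ?_
      simp
    refine (Finset.sum_le_sum fun i _ => this i).trans_eq ?_
    rw [Finset.sum_const, Finset.card_univ, nsmul_eq_mul]
  linarith

open Matrix in
/-- Determinant bound for a matrix whose columns, together with the origin, have all mutual
distances at most `a`. -/
theorem Matrix.abs_det_le_of_col_dist_le (r : ℕ) (hr : 1 ≤ r) (a : ℝ) (ha : 0 ≤ a)
    (w : Fin r → EuclideanSpace ℝ (Fin r))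
    (hw : ∀ i, ‖w i‖ ≤ a) (hww : ∀ i j, i ≠ j → ‖w i - w j‖ ≤ a) :
    |(Matrix.of fun i j => w j i).det| ≤ √((r : ℝ) + 1) * (a / √2) ^ r := by
  have : NeZero r := ⟨by omega⟩
  have hr0 : (0 : ℝ) < r := by exact_mod_cast hr
  set A : Matrix (Fin r) (Fin r) ℝ := Matrix.of fun i j => w j i
  set s : ℝ := √((r : ℝ) + 1)
  have hs : s ^ 2 = r + 1 := Real.sq_sqrt (by positivity)
  have hs0 : 0 < s := by positivity
  set c : ℝ := (1 - 1 / s) / r with hc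
  set P := A * (1 - c • Matrix.of fun _ _ => 1) with hP
  have hrc : r * c = 1 - 1 / s := by rw [hc]; field_simp
  have hcc : 2 * c - r * c ^ 2 = 1 / (r + 1) := by
    rw [← mul_right_inj' hr0.ne']
    have : r * (2 * c - r * c ^ 2) = 2 * (r * c) - (r * c) ^ 2 := by ring
    rw [this, hrc, ← hs]
    have : (r : ℝ) = s ^ 2 - 1 := by linarith
    rw [this]
    field_simp
    ring
  have hdet : P.det = A.det / s := by
    rw [hP, det_mul, det_one_sub_smul_ones, Fintype.card_fin, hrc]
    ring
  have hcol (i j) : P i j = (w j - c • ∑ k, w k) i := by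
    simp [hP, A, mul_sub, mul_apply, Finset.mul_sum, mul_comm]
  have htr : (Pᵀ * P).trace = ∑ j, ‖w j - c • ∑ k, w k‖ ^ 2 := by
    simp only [trace, diag_apply, mul_apply, transpose_apply, EuclideanSpace.norm_sq_eq, hcol,
      Real.norm_eq_abs, sq_abs, ← sq]
  have htr2 : (Pᵀ * P).trace = ∑ j, ‖w j‖ ^ 2 - 1 / (r + 1) * ‖∑ k, w k‖ ^ 2 := by
    rw [htr, ← hcc, ← real_inner_self_eq_norm_sq (∑ i, w i)]
    simp only [norm_sub_sq_real, Finset.sum_add_distrib, Finset.sum_sub_distrib, norm_smul,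
      mul_pow, inner_smul_right, ← Finset.mul_sum, ← sum_inner, Finset.sum_const,
      Finset.card_univ, Fintype.card_fin, nsmul_eq_mul, Real.norm_eq_abs, sq_abs,
      real_inner_self_eq_norm_sq]
    ring
  have hkey := card_add_one_mul_sum_norm_sq_sub_norm_sum_sq_le w a hw hww
  rw [Fintype.card_fin] at hkey
  have htr3 : (Pᵀ * P).trace / r ≤ a ^ 2 / 2 := by
    rw [htr2, div_le_iff₀ hr0, ← mul_le_mul_iff_right₀ (show (0 : ℝ) < r + 1 by positivity)]
    refine le_of_eq_of_le ?_ (hkey.trans_eq (by ring))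
    field_simp
  have hnn : 0 ≤ (Pᵀ * P).trace / r := by rw [htr]; positivity
  have h := P.det_sq_le_trace_div_card_pow
  rw [Fintype.card_fin] at h
  have h' := h.trans (pow_le_pow_left₀ hnn htr3 r)
  rw [hdet, div_pow, div_le_iff₀ (by positivity)] at h'
  refine abs_le_of_sq_le_sq (h'.trans_eq ?_) (by positivity)
  rw [mul_pow, ← pow_mul, mul_comm r 2, pow_mul, div_pow a, Real.sq_sqrt zero_le_two]
  ring

open MeasureTheory Matrix in
theorem volume_convexHull_range_le (r : ℕ) [NeZero r]
    (v : Fin (r + 1) → EuclideanSpace ℝ (Fin r)) :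
    volume (convexHull ℝ (Set.range v)) ≤
      ENNReal.ofReal (|(Matrix.of fun i j => (v j.succ - v 0) i).det| *
        (1 / (Nat.factorial r : ℝ))) := by
  set A : Matrix (Fin r) (Fin r) ℝ := Matrix.of fun i j => (v j.succ - v 0) i with hA
  set S : Set (Fin r → ℝ) := {x | (∀ i, 0 ≤ x i) ∧ ∑ i, x i ≤ 1} with hS
  have hSc : Convex ℝ S := by
    rintro x ⟨hx0, hx1⟩ y ⟨hy0, hy1⟩ p q hp hq hpq
    refine ⟨fun i => ?_, ?_⟩
    · have := hx0 i
      have := hy0 i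
      simp only [Pi.add_apply, Pi.smul_apply, smul_eq_mul]
      positivity
    · simp only [Pi.add_apply, Pi.smul_apply, smul_eq_mul, Finset.sum_add_distrib,
        ← Finset.mul_sum]
      nlinarith
  set T : Set (Fin r → ℝ) := (fun z => WithLp.ofLp (v 0) + z) '' (toLin' A '' S) with hT
  have hTc : Convex ℝ T := (hSc.linear_image _).translate _
  have hsub : convexHull ℝ (Set.range v) ⊆ (WithLp.ofLp : EuclideanSpace ℝ (Fin r) → _) ⁻¹' T := by
    refine convexHull_min ?_
      (hTc.linear_preimage (WithLp.linearEquiv 2 ℝ (Fin r → ℝ)).toLinearMap)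
    rintro _ ⟨i, rfl⟩
    refine Fin.cases ?_ (fun j => ?_) i
    · exact ⟨0, ⟨0, by simp [hS], by simp⟩, by simp⟩
    · refine ⟨_, ⟨Pi.single j 1, ⟨fun k => ?_, by simp⟩, rfl⟩, ?_⟩
      · by_cases h : k = j
        · subst h; simp
        · simp [h]
      · ext k
        simp [hA]
  calc volume (convexHull ℝ (Set.range v))
      ≤ volume ((WithLp.ofLp : EuclideanSpace ℝ (Fin r) → _) ⁻¹' T) := measure_mono hsub
    _ = volume T := (PiLp.volume_preserving_ofLp (Fin r)).measure_preimage_emb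
        (MeasurableEquiv.toLp 2 (Fin r → ℝ)).symm.measurableEmbedding T
    _ = ENNReal.ofReal |A.det| * volume S := by
        rw [hT, Set.image_add_left, measure_preimage_add, Measure.addHaar_image_linearMap,
          LinearMap.det_toLin']
    _ ≤ _ := by
        rw [ENNReal.ofReal_mul (abs_nonneg _)]
        gcongr
        exact volume_corner_simplex_le r

/-- (Volume bound for simplices with short edges) If `v¹,…,v^{r+1} ∈ ℝ^r` have all pairwise
Euclidean distances at most `a > 0`, then the Lebesgue measure of `conv{v¹,…,v^{r+1}}` is at
most `(√(r+1)/r!) · (a/√2)^r`, the volume of a regular r-simplex with edge length `a`. -/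
theorem volume_bound_short_edges (r : ℕ) (hr : 1 ≤ r) (a : ℝ) (ha : 0 < a)
    (v : Fin (r + 1) → EuclideanSpace ℝ (Fin r))
    (hdist : ∀ i j, i ≠ j → ‖v i - v j‖ ≤ a) :
    MeasureTheory.volume (convexHull ℝ (Set.range v)) ≤
      ENNReal.ofReal (Real.sqrt ((r : ℝ) + 1) / (Nat.factorial r : ℝ) *
        (a / Real.sqrt 2) ^ r) := by
  have : NeZero r := ⟨by omega⟩
  refine (volume_convexHull_range_le r v).trans (ENNReal.ofReal_le_ofReal ?_)
  have h := Matrix.abs_det_le_of_col_dist_le r hr a ha.le (fun j => v j.succ - v 0)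
    (fun i => hdist _ _ (Fin.succ_ne_zero i))
    (fun i j hij => by simpa using hdist i.succ j.succ (by simpa using hij))
  refine (mul_le_mul_of_nonneg_right h (by positivity)).trans_eq ?_
  ring
end

section
/- (Theorem 4, partition counting bound) Let r ≥ 1, a > 0, and let y̱, ȳ ∈ ℝ^r satisfy y̱ᵢ < ȳᵢ for all i. Let S₀ = conv{y̱, y̱ + r(ȳ₁ − y̱₁)e₁, …, y̱ + r(ȳ_r − y̱_r)e_r}. Suppose S₀ = S₁ ∪ ⋯ ∪ S_N, where each S_t is the convex hull of r+1 points of ℝ^r whose pairwise Euclidean distances are all at most a, and the interiors of S₁,…,S_N are pairwise disjoint. Then N · (√(r+1)/r!) · (a/√2)^r ≥ r^r ∏_{i=1}^r (ȳᵢ − y̱ᵢ) / r!, i.e., N ≥ (∏_{i=1}^r (ȳᵢ − y̱ᵢ) / √(r+1)) · (√2 r / a)^r. -/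
/-- The determinant of a positive semidefinite matrix is at most the `n`-th power of the mean of
its eigenvalues. -/
theorem Matrix.PosSemidef.det_le_trace_div_card_pow {n : Type*} [Fintype n] [DecidableEq n]
    [Nonempty n] {B : Matrix n n ℝ} (hB : B.PosSemidef) :
    B.det ≤ (B.trace / Fintype.card n) ^ Fintype.card n := by
  have hdet : B.det = ∏ i, hB.isHermitian.eigenvalues i := by
    simpa using hB.isHermitian.det_eq_prod_eigenvalues
  have htr : B.trace = ∑ i, hB.isHermitian.eigenvalues i := by
    simpa using hB.isHermitian.trace_eq_sum_eigenvalues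
  rw [hdet, htr]
  have h := Real.geom_mean_le_arith_mean Finset.univ (fun _ => 1) hB.isHermitian.eigenvalues
    (by simp) (by simpa using Fintype.card_pos) fun i _ => hB.eigenvalues_nonneg i
  simp only [Real.rpow_one, one_mul, Finset.sum_const, Finset.card_univ, nsmul_eq_mul,
    mul_one] at h
  have hprod : 0 ≤ ∏ i, hB.isHermitian.eigenvalues i :=
    Finset.prod_nonneg fun i _ => hB.eigenvalues_nonneg i
  calc _ = ((∏ i, hB.isHermitian.eigenvalues i) ^ (Fintype.card n : ℝ)⁻¹) ^ Fintype.card n :=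
        (Real.rpow_inv_natCast_pow hprod Fintype.card_ne_zero).symm
    _ ≤ _ := by gcongr

/-- Squared determinant of the edge vectors of a simplex, compared with the sum of all squared
edge lengths. -/
theorem Matrix.det_sq_le_of_edges {n : Type*} [Fintype n] [DecidableEq n] [Nonempty n]
    (A : Matrix n n ℝ) (a : ℝ)
    (h0 : ∀ i, ∑ k, A k i ^ 2 ≤ a ^ 2)
    (h : ∀ i j, i ≠ j → ∑ k, (A k i - A k j) ^ 2 ≤ a ^ 2) :
    A.det ^ 2 ≤ (Fintype.card n + 1) * (a ^ 2 / 2) ^ Fintype.card n := by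
  set r : ℝ := (Fintype.card n : ℝ) with hr
  have hr0 : (0 : ℝ) < r := by rw [hr]; exact_mod_cast Fintype.card_pos
  set C : Matrix n n ℝ := 1 - (r + 1)⁻¹ • Matrix.of (fun _ _ => (1 : ℝ)) with hC
  have hCdet : C.det = (r + 1)⁻¹ := by
    have : C = 1 + Matrix.replicateCol Unit (fun _ : n => -(r + 1)⁻¹) *
        Matrix.replicateRow Unit (fun _ : n => (1 : ℝ)) := by
      ext i j
      simp [hC, Matrix.mul_apply, sub_eq_add_neg]
    rw [this, Matrix.det_one_add_replicateCol_mul_replicateRow]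
    simp [dotProduct, ← hr]
    field_simp
    ring
  have hCpsd : C.PosSemidef := by
    refine .of_dotProduct_mulVec_nonneg ?_ fun x => ?_
    · ext i j
      simp [hC, Matrix.one_apply, eq_comm]
    · have hx : star x ⬝ᵥ (C.mulVec x) = ∑ i, x i ^ 2 - (r + 1)⁻¹ * (∑ i, x i) ^ 2 := by
        rw [hC, Matrix.sub_mulVec, Matrix.one_mulVec, Matrix.smul_mulVec, dotProduct_sub,
          dotProduct_smul]
        simp [dotProduct, Matrix.mulVec, pow_two, ← Finset.sum_mul]
      have hcs : (∑ i, x i) ^ 2 ≤ r * ∑ i, x i ^ 2 := by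
        simpa [hr] using sq_sum_le_card_mul_sum_sq (s := Finset.univ) (f := x)
      have hs : 0 ≤ ∑ i, x i ^ 2 := Finset.sum_nonneg fun i _ => sq_nonneg _
      rw [hx, sub_nonneg, inv_mul_le_iff₀ (by positivity)]
      linarith
  have hB : (A * C * A.transpose).PosSemidef := by
    simpa using hCpsd.mul_mul_conjTranspose_same A
  have hBdet : (A * C * A.transpose).det = A.det ^ 2 * (r + 1)⁻¹ := by
    simp [hCdet]
    ring
  have hBtr : (A * C * A.transpose).trace ≤ r * (a ^ 2 / 2) := by
    have h1 : (A * C * A.transpose).trace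
        = ∑ k, (∑ i, A k i ^ 2 - (r + 1)⁻¹ * (∑ i, A k i) ^ 2) := by
      refine Finset.sum_congr rfl fun k _ => ?_
      simp [hC, Matrix.mul_sub, Matrix.sub_mul, Matrix.mul_apply, ← Finset.mul_sum,
        ← Finset.sum_mul, pow_two]
      ring
    have h2 : ∀ k, ∑ i, ∑ j, (A k i - A k j) ^ 2
        = 2 * (r * ∑ i, A k i ^ 2 - (∑ i, A k i) ^ 2) := fun k => by
      simp [sub_sq, Finset.sum_add_distrib, ← Finset.mul_sum, ← Finset.sum_mul, ← hr]
      ring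
    have h3 : ∑ k, ∑ i, ∑ j, (A k i - A k j) ^ 2 ≤ r * (r - 1) * a ^ 2 := by
      rw [Finset.sum_comm]
      have : ∀ i, ∑ k, ∑ j, (A k i - A k j) ^ 2 ≤ (r - 1) * a ^ 2 := fun i => by
        rw [Finset.sum_comm, ← Finset.add_sum_erase _ _ (Finset.mem_univ i)]
        have := Finset.sum_le_card_nsmul (Finset.univ.erase i)
          (fun j => ∑ k, (A k i - A k j) ^ 2) (a ^ 2)
          fun j hj => h i j (Finset.ne_of_mem_erase hj).symm
        rw [Finset.card_erase_of_mem (Finset.mem_univ i), nsmul_eq_mul,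
          Nat.cast_sub (by simpa using Fintype.card_pos (α := n).nat_succ_le)] at this
        simpa [← hr] using this
      refine (Finset.sum_le_card_nsmul Finset.univ _ _ fun i _ => this i).trans_eq ?_
      simp [← hr, mul_assoc]
    have h4 : ∑ k, ∑ i, A k i ^ 2 ≤ r * a ^ 2 := by
      rw [Finset.sum_comm]
      simpa [← hr] using Finset.sum_le_card_nsmul Finset.univ _ _ fun i _ => h0 i
    simp only [h2, ← Finset.mul_sum, Finset.sum_sub_distrib] at h3
    rw [h1, Finset.sum_sub_distrib, ← Finset.mul_sum]
    refine le_of_mul_le_mul_left ?_ (show 0 < r + 1 by positivity)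
    rw [mul_sub, mul_inv_cancel_left₀ (by positivity)]
    linarith
  have key := hB.det_le_trace_div_card_pow
  rw [hBdet, ← hr, ← div_eq_mul_inv, div_le_iff₀ (by positivity)] at key
  rw [mul_comm (r + 1)]
  refine key.trans ?_
  have h0tr : 0 ≤ (A * C * A.transpose).trace / r := div_nonneg hB.trace_nonneg hr0.le
  have hmean : (A * C * A.transpose).trace / r ≤ a ^ 2 / 2 := by
    rw [div_le_iff₀ hr0]
    linarith
  gcongr ?_ ^ _ * _

open MeasureTheory
open scoped Pointwise

/-- The convex hull of `{0, e₁, …, e_r}`. -/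
def cornerSimplex (r : ℕ) : Set (EuclideanSpace ℝ (Fin r)) :=
  convexHull ℝ (Set.range (Fin.cons 0 fun i => EuclideanSpace.single i 1))

/-- The matrix whose columns are the edge vectors of a simplex at its vertex `0`. -/
def edgeMatrix {r : ℕ} (p : Fin (r + 1) → EuclideanSpace ℝ (Fin r)) : Matrix (Fin r) (Fin r) ℝ :=
  Matrix.of fun k i => p i.succ k - p 0 k

/-- The volume of a simplex in terms of the determinant of its edge vectors. -/
theorem volume_convexHull_range {r : ℕ} (p : Fin (r + 1) → EuclideanSpace ℝ (Fin r)) :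
    volume (convexHull ℝ (Set.range p))
      = ENNReal.ofReal |(edgeMatrix p).det| * volume (cornerSimplex r) := by
  let L : EuclideanSpace ℝ (Fin r) →ₗ[ℝ] EuclideanSpace ℝ (Fin r) :=
    Matrix.toLin (EuclideanSpace.basisFun (Fin r) ℝ).toBasis
      (EuclideanSpace.basisFun (Fin r) ℝ).toBasis (edgeMatrix p)
  have hrange : Set.range p
      = p 0 +ᵥ (L '' Set.range (Fin.cons 0 fun i => EuclideanSpace.single i 1)) := by
    rw [← Set.range_comp, ← Set.image_vadd, ← Set.range_comp]
    congr 1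
    ext i k
    refine Fin.cases ?_ (fun i => ?_) i
    · simp
    · have := Matrix.toLin_self (EuclideanSpace.basisFun (Fin r) ℝ).toBasis
        (EuclideanSpace.basisFun (Fin r) ℝ).toBasis (edgeMatrix p) i
      simp only [OrthonormalBasis.coe_toBasis, EuclideanSpace.basisFun_apply] at this
      simp only [Function.comp_apply, Fin.cons_succ, L, this]
      simp [edgeMatrix, Pi.single_apply]
  rw [hrange, convexHull_vadd, ← L.image_convexHull, measure_vadd,
    Measure.addHaar_image_linearMap, LinearMap.det_toLin, cornerSimplex]

theorem volume_cornerSimplex_ne_top (r : ℕ) : volume (cornerSimplex r) ≠ ⊤ :=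
  ((Set.finite_range _).isCompact_convexHull ℝ).measure_ne_top

theorem volume_cornerSimplex_ne_zero (r : ℕ) : volume (cornerSimplex r) ≠ 0 := by
  have hne : (interior (cornerSimplex r)).Nonempty := by
    rw [cornerSimplex, interior_convexHull_nonempty_iff_affineSpan_eq_top,
      AffineSubspace.affineSpan_eq_top_iff_vectorSpan_eq_top_of_nonempty _ _ _
        (Set.range_nonempty _), vectorSpan_range_eq_span_range_vsub_right ℝ _ 0, eq_top_iff,
      ← (EuclideanSpace.basisFun (Fin r) ℝ).toBasis.span_eq]
    refine Submodule.span_mono ?_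
    rintro _ ⟨i, rfl⟩
    exact ⟨i.succ, by simp⟩
  exact ne_of_gt (Measure.measure_pos_of_nonempty_interior _ hne)

/-- A simplex with edges of length at most `a` has at most the volume of the regular one. -/
theorem abs_det_edgeMatrix_le {r : ℕ} (hr : 1 ≤ r) {a : ℝ} (ha : 0 ≤ a)
    (p : Fin (r + 1) → EuclideanSpace ℝ (Fin r)) (hp : ∀ i j, i ≠ j → ‖p i - p j‖ ≤ a) :
    |(edgeMatrix p).det| ≤ √(r + 1) * (a / √2) ^ r := by
  have : Nonempty (Fin r) := ⟨⟨0, hr⟩⟩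
  have hsq : ∀ i j, i ≠ j → ∑ k, (p i k - p j k) ^ 2 ≤ a ^ 2 := fun i j hij => by
    have := pow_le_pow_left₀ (norm_nonneg _) (hp i j hij) 2
    simpa [EuclideanSpace.real_norm_sq_eq] using this
  have h := Matrix.det_sq_le_of_edges (edgeMatrix p) a
    (fun i => by simpa [edgeMatrix] using hsq i.succ 0 (Fin.succ_ne_zero i))
    (fun i j hij => by simpa [edgeMatrix] using hsq i.succ j.succ (by simpa using hij))
  refine abs_le_of_sq_le_sq ?_ (by positivity)
  rw [mul_pow, Real.sq_sqrt (by positivity), ← pow_mul, mul_comm r, pow_mul, div_pow,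
    Real.sq_sqrt (by positivity)]
  simpa using h

/-- (Theorem 4, partition counting bound) If the initial simplex `S₀` is covered by `N`
simplices with pairwise disjoint interiors, each being the convex hull of `r+1` points with
pairwise Euclidean distances at most `a`, then
`N · (√(r+1)/r!) · (a/√2)^r ≥ r^r ∏ᵢ (ȳᵢ − y̱ᵢ) / r!`. -/
theorem partition_counting_bound (r N : ℕ) (hr : 1 ≤ r) (a : ℝ) (ha : 0 < a)
    (ylo yhi : EuclideanSpace ℝ (Fin r)) (hlt : ∀ i, ylo i < yhi i)
    (v : Fin (r + 1) → EuclideanSpace ℝ (Fin r))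
    (hv0 : v 0 = ylo)
    (hvs : ∀ i : Fin r, v i.succ =
      fun j => if j = i then ylo i + r * (yhi i - ylo i) else ylo j)
    (V : Fin N → Fin (r + 1) → EuclideanSpace ℝ (Fin r))
    (hVa : ∀ t, ∀ i j, i ≠ j → ‖V t i - V t j‖ ≤ a)
    (hcover : convexHull ℝ (Set.range v) = ⋃ t, convexHull ℝ (Set.range (V t)))
    (hdisj : ∀ t s, t ≠ s →
      Disjoint (interior (convexHull ℝ (Set.range (V t))))
        (interior (convexHull ℝ (Set.range (V s))))) :
    (N : ℝ) * (Real.sqrt ((r : ℝ) + 1) / (Nat.factorial r : ℝ) * (a / Real.sqrt 2) ^ r) ≥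
      (r : ℝ) ^ r * (∏ i, (yhi i - ylo i)) / (Nat.factorial r : ℝ) := by
  have hv : (edgeMatrix v).det = (r : ℝ) ^ r * ∏ i, (yhi i - ylo i) := by
    have : edgeMatrix v = Matrix.diagonal fun i => r * (yhi i - ylo i) := by
      ext k i
      by_cases hki : k = i <;> simp [edgeMatrix, hv0, hvs, hki]
    rw [this, Matrix.det_diagonal, Finset.prod_mul_distrib]
    simp
  have hle : |(edgeMatrix v).det| ≤ N * (√(r + 1) * (a / √2) ^ r) := by
    have hvol : volume (convexHull ℝ (Set.range v))
        ≤ ∑ t, volume (convexHull ℝ (Set.range (V t))) := by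
      rw [hcover]
      exact measure_iUnion_fintype_le _ _
    simp only [volume_convexHull_range] at hvol
    rw [← Finset.sum_mul, ENNReal.mul_le_mul_iff_left (volume_cornerSimplex_ne_zero r)
      (volume_cornerSimplex_ne_top r), ← ENNReal.ofReal_sum_of_nonneg fun _ _ => abs_nonneg _,
      ENNReal.ofReal_le_ofReal_iff (Finset.sum_nonneg fun _ _ => abs_nonneg _)] at hvol
    refine hvol.trans ((Finset.sum_le_card_nsmul _ _ _ fun t _ =>
      abs_det_edgeMatrix_le hr ha.le (V t) (hVa t)).trans_eq ?_)
    simp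
  have := (le_abs_self _).trans hle
  rw [hv] at this
  rw [ge_iff_le, div_mul_eq_mul_div, mul_div_assoc']
  gcongr
end
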